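/- GL(n, ℤ) contains only finitely many conjugacy classes of elements of finite order. -/

import Mathlib

open Matrix

theorem fin_of_inv {α : Type*} [Monoid α] (p : α → Prop) {σ : Type*} [Finite σ]
    (r : α → σ → Prop) (tot : ∀ a, p a → ∃ s, r a s)
    (h : ∀ a b s, p a → p b → r a s → r b s → IsConj a b) :
    (ConjClasses.mk '' {a | p a}).Finite := by
  classical
  choose f hf using tot
  have : Finite (ConjClasses.mk '' {a | p a}) := by
    refine Finite.of_injective (β := σ)
      (fun c => f (Classical.choose c.2) (Classical.choose_spec c.2).1) ?_
    intro c d hcd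
    have hc := Classical.choose_spec c.2
    have hd := Classical.choose_spec d.2
    apply Subtype.ext
    rw [← hc.2, ← hd.2]
    refine ConjClasses.mk_eq_mk_iff_isConj.2 (h _ _ _ hc.1 hd.1 (hf _ hc.1) ?_)
    have h2 := hf _ hd.1
    have hcd2 : f _ hc.1 = f _ hd.1 := hcd
    rw [hcd2]; exact h2
  exact Set.toFinite _

def bseq {a b : ℕ} (A : Matrix (Fin a) (Fin a) ℤ) (D : Matrix (Fin b) (Fin b) ℤ)
    (Y : Matrix (Fin a) (Fin b) ℤ) : ℕ → Matrix (Fin a) (Fin b) ℤ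
  | 0 => 0
  | k + 1 => A * bseq A D Y k + Y * D ^ k

theorem blk_pow {a b : ℕ} (A : Matrix (Fin a) (Fin a) ℤ) (D : Matrix (Fin b) (Fin b) ℤ)
    (Y : Matrix (Fin a) (Fin b) ℤ) (k : ℕ) :
    (fromBlocks A Y 0 D) ^ k = fromBlocks (A ^ k) (bseq A D Y k) 0 (D ^ k) := by
  induction k with
  | zero => simp [bseq, fromBlocks_one]
  | succ k ih => rw [pow_succ', ih, fromBlocks_multiply]; simp [bseq, pow_succ']

theorem sq_smul_sub {a b : ℕ} (A : Matrix (Fin a) (Fin a) ℤ) (D : Matrix (Fin b) (Fin b) ℤ)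
    (Y Y' Z : Matrix (Fin a) (Fin b) ℤ) (m : ℤ) (h : Y' - Y = m • Z) (k : ℕ) :
    m • bseq A D Z k = bseq A D Y' k - bseq A D Y k := by
  induction k with
  | zero => simp [bseq]
  | succ k ih =>
    simp only [bseq, smul_add]
    rw [← Matrix.mul_smul, ih, ← Matrix.smul_mul, ← h, Matrix.mul_sub, Matrix.sub_mul]
    abel

theorem sq_zero_of_tors {a b : ℕ} (A : Matrix (Fin a) (Fin a) ℤ) (D : Matrix (Fin b) (Fin b) ℤ)
    (Y : Matrix (Fin a) (Fin b) ℤ) (m : ℕ) (hA : A ^ m = 1) (hD : D ^ m = 1)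
    (h : IsOfFinOrder (fromBlocks A Y 0 D)) : bseq A D Y m = 0 := by
  obtain ⟨k, hk, hk1⟩ := isOfFinOrder_iff_pow_eq_one.1 h
  have h1 : ((fromBlocks A Y 0 D) ^ m) ^ k = 1 := by rw [pow_right_comm, hk1, one_pow]
  rw [blk_pow, hA, hD, blk_pow] at h1
  have h2 : ∀ (W : Matrix (Fin a) (Fin b) ℤ) k, bseq 1 1 W k = (k : ℤ) • W := by
    intro W k
    induction k with
    | zero => simp [bseq]
    | succ k ih => simp only [bseq, ih, Matrix.one_mul, one_pow, Matrix.mul_one]; push_cast; rw [add_smul, one_smul]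
  rw [h2, ← fromBlocks_one, fromBlocks_inj] at h1
  have := h1.2.1
  exact (smul_eq_zero.1 this).resolve_left (by exact_mod_cast hk.ne')

theorem conj_of_congr {a b : ℕ} (A : Matrix (Fin a) (Fin a) ℤ) (D : Matrix (Fin b) (Fin b) ℤ)
    (Y Y' Z : Matrix (Fin a) (Fin b) ℤ) (m : ℕ) (hm : 0 < m) (hA : A ^ m = 1) (hD : D ^ m = 1)
    (h : IsOfFinOrder (fromBlocks A Y 0 D)) (h' : IsOfFinOrder (fromBlocks A Y' 0 D))
    (hZ : Y' - Y = (m : ℤ) • Z) : IsConj (fromBlocks A Y 0 D) (fromBlocks A Y' 0 D) := by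
  have h0 : bseq A D Z m = 0 := by
    have := sq_smul_sub A D Y Y' Z m hZ m
    rw [sq_zero_of_tors A D Y m hA hD h, sq_zero_of_tors A D Y' m hA hD h', sub_zero] at this
    exact (smul_eq_zero.1 this).resolve_left (by exact_mod_cast hm.ne')
  set u : ℕ → Matrix (Fin a) (Fin b) ℤ := fun k => bseq A D Z k * D ^ (m - k) with hu
  have hrec : ∀ k < m, u (k + 1) * D - A * u k = Z := by
    intro k hk
    simp only [hu, bseq]
    rw [Matrix.mul_assoc, ← pow_succ, show m - (k+1) + 1 = m - k by omega, Matrix.add_mul,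
      Matrix.mul_assoc Z, ← pow_add, show k + (m - k) = m by omega, hD]
    simp [Matrix.mul_assoc]
  have hs := Finset.sum_congr (rfl : Finset.range m = Finset.range m)
    (fun k hk => hrec k (Finset.mem_range.1 hk))
  have e1 : ∑ k ∈ Finset.range m, u (k + 1) = ∑ k ∈ Finset.range m, u k := by
    have h1 := Finset.sum_range_succ u m
    rw [Finset.sum_range_succ'] at h1
    simpa [hu, h0, bseq] using h1
  rw [Finset.sum_sub_distrib, ← Matrix.sum_mul, ← Matrix.mul_sum, e1] at hs
  set X := ∑ k ∈ Finset.range m, u k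
  have hX : X * D - A * X = Y' - Y := by
    rw [hs, hZ]; simp
  refine ⟨⟨fromBlocks 1 X 0 1, fromBlocks 1 (-X) 0 1, ?_, ?_⟩, ?_⟩
  · simp [fromBlocks_multiply, fromBlocks_one]
  · simp [fromBlocks_multiply, fromBlocks_one]
  · simp only [SemiconjBy, fromBlocks_multiply]
    simp
    rw [sub_eq_sub_iff_add_eq_add] at hX
    rw [add_comm, hX, add_comm]

theorem IsConj.tors {α : Type*} [Monoid α] {x y : α} (h : IsConj x y) (hx : IsOfFinOrder x) :
    IsOfFinOrder y := by
  obtain ⟨k, hk, hk1⟩ := isOfFinOrder_iff_pow_eq_one.1 hx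
  obtain ⟨c, hc⟩ := h
  refine isOfFinOrder_iff_pow_eq_one.2 ⟨k, hk, ?_⟩
  have := hc.pow_right k
  rw [hk1, SemiconjBy, mul_one] at this
  have h2 := congrArg (· * (↑c⁻¹ : α)) this
  simpa [mul_assoc] using h2.symm

/-- map of conjugacy -/
theorem IsConj.map' {α β : Type*} [Monoid α] [Monoid β] (f : α →* β) {x y : α} (h : IsConj x y) :
    IsConj (f x) (f y) := f.map_isConj h

theorem fin_block {n a b : ℕ} (e : Fin a ⊕ Fin b ≃ Fin n) (A : Matrix (Fin a) (Fin a) ℤ)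
    (D : Matrix (Fin b) (Fin b) ℤ) (hA : IsOfFinOrder A) (hD : IsOfFinOrder D) :
    (ConjClasses.mk '' {M : Matrix (Fin n) (Fin n) ℤ | IsOfFinOrder M ∧
      ∃ B, IsConj (reindexAlgEquiv ℤ ℤ e (fromBlocks A B 0 D)) M}).Finite := by
  obtain ⟨k, hk, hk1⟩ := isOfFinOrder_iff_pow_eq_one.1 hA
  obtain ⟨l, hl, hl1⟩ := isOfFinOrder_iff_pow_eq_one.1 hD
  have hm : 0 < k * l := Nat.mul_pos hk hl
  have hAm : A ^ (k * l) = 1 := by rw [pow_mul, hk1, one_pow]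
  have hDm : D ^ (k * l) = 1 := by rw [mul_comm, pow_mul, hl1, one_pow]
  generalize k * l = m at *
  have : NeZero m := ⟨hm.ne'⟩
  refine fin_of_inv (σ := Matrix (Fin a) (Fin b) (ZMod m)) _
    (fun M s => ∃ B, IsConj (reindexAlgEquiv ℤ ℤ e (fromBlocks A B 0 D)) M ∧
      B.map (Int.cast : ℤ → ZMod m) = s) ?_ ?_
  · rintro M ⟨-, B, hB⟩
    exact ⟨_, B, hB, rfl⟩
  · rintro M N s ⟨hM, -⟩ ⟨hN, -⟩ ⟨B, hB, hBs⟩ ⟨B', hB', hBs'⟩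
    refine (hB.symm.trans ?_).trans hB'
    have tor : ∀ (B) (M : Matrix (Fin n) (Fin n) ℤ), IsOfFinOrder M →
        IsConj (reindexAlgEquiv ℤ ℤ e (fromBlocks A B 0 D)) M →
        IsOfFinOrder (fromBlocks A B 0 D) := by
      intro B M hM h
      have := h.symm.tors hM
      have h3 := MonoidHom.isOfFinOrder (reindexAlgEquiv ℤ ℤ e).symm.toMulEquiv.toMonoidHom this
      have h4 : (reindexAlgEquiv ℤ ℤ e).symm.toMulEquiv.toMonoidHom
        (reindexAlgEquiv ℤ ℤ e (fromBlocks A B 0 D)) = fromBlocks A B 0 D :=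
        (reindexAlgEquiv ℤ ℤ e).symm_apply_apply _
      rwa [h4] at h3
    have hdiv : ∀ i j, ∃ z, (B' - B) i j = (m : ℤ) * z := by
      intro i j
      have h1 := congrFun (congrFun (hBs'.trans hBs.symm) i) j
      simp only [map_apply] at h1
      exact (ZMod.intCast_eq_intCast_iff_dvd_sub _ _ _).1 h1.symm
    choose Z hZ using hdiv
    have := conj_of_congr A D B B' (Matrix.of Z) m hm hAm hDm (tor _ _ hM hB) (tor _ _ hN hB')
      (by ext i j; rw [hZ]; simp)
    exact this.map' (reindexAlgEquiv ℤ ℤ e).toMulEquiv.toMonoidHom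

/-- Krylov matrix. -/
def kry {n : ℕ} (M : Matrix (Fin n) (Fin n) ℤ) (v : Fin n → ℤ) : Matrix (Fin n) (Fin n) ℤ :=
  Matrix.of fun i j => ((M ^ (j : ℕ)) *ᵥ v) i

/-- Companion matrix. -/
def compan {n : ℕ} (f : Polynomial ℤ) : Matrix (Fin n) (Fin n) ℤ :=
  Matrix.of fun i j => if (j : ℕ) + 1 < n then (if (i : ℕ) = j + 1 then 1 else 0)
    else - f.coeff i

theorem kry_comp {n : ℕ} (M : Matrix (Fin n) (Fin n) ℤ) (v : Fin n → ℤ) :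
    M * kry M v = kry M v * compan M.charpoly := by
  ext i j
  have h1 : (M * kry M v) i j = ((M ^ ((j : ℕ) + 1)) *ᵥ v) i := by
    rw [pow_succ', ← mulVec_mulVec]; rfl
  rw [h1, mul_apply]
  by_cases hj : (j : ℕ) + 1 < n
  · rw [Finset.sum_eq_single (⟨j + 1, hj⟩ : Fin n)]
    · simp [kry, compan, hj]
    · intro b _ hb
      have : (b : ℕ) ≠ j + 1 := fun h => hb (Fin.ext h)
      simp [compan, hj, this]
    · simp
  · have hn : (j : ℕ) + 1 = n := by omega
    rw [hn]
    have hch := M.aeval_self_charpoly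
    have hdeg : M.charpoly.natDegree = n := by simp [Matrix.charpoly_natDegree_eq_dim]
    have hmon := M.charpoly_monic
    rw [Polynomial.aeval_eq_sum_range, hdeg, Finset.sum_range_succ] at hch
    have hlead : M.charpoly.coeff n = 1 := by
      have := hmon.coeff_natDegree
      rwa [hdeg] at this
    rw [hlead, one_smul, add_comm, add_eq_zero_iff_eq_neg] at hch
    have hsum := Fin.sum_univ_eq_sum_range (fun k => M.charpoly.coeff k • M ^ k) n
    rw [hch, ← hsum, neg_mulVec, Pi.neg_apply, Matrix.sum_mulVec, Finset.sum_apply,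
      ← Finset.sum_neg_distrib]
    refine Finset.sum_congr rfl fun b _ => ?_
    simp only [kry, compan, of_apply, hj, if_false, smul_mulVec, Pi.smul_apply, smul_eq_mul]
    ring

theorem kry_map {n : ℕ} (P M C : Matrix (Fin n) (Fin n) ℤ) (h : P * M = C * P) (v : Fin n → ℤ) :
    P * kry M v = kry C (P *ᵥ v) := by
  ext i j
  have h1 : (P * kry M v) i j = (P *ᵥ ((M ^ (j : ℕ)) *ᵥ v)) i := rfl
  have h2 : SemiconjBy P M C := h
  have h3 := h2.pow_right (j : ℕ)
  rw [h1, mulVec_mulVec, h3.eq, ← mulVec_mulVec]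
  rfl

theorem kry_bound {n : ℕ} (C : Matrix (Fin n) (Fin n) ℤ) : ∃ c : ℕ, ∀ (k : ℕ) (u : Fin n → ℤ),
    (∀ i, |u i| ≤ k) → (kry C u).det.natAbs ≤ c * k ^ n := by
  let B : ℕ := ∑ j : Fin n, ∑ i : Fin n, ∑ l : Fin n, ((C ^ (j : ℕ)) i l).natAbs
  refine ⟨n.factorial * B ^ n, fun k u hu => ?_⟩
  have h1 : ∀ i j, AbsoluteValue.abs (kry C u i j) ≤ (B : ℤ) * k := by
    intro i j
    simp only [kry, of_apply, mulVec, dotProduct, AbsoluteValue.abs_apply]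
    refine (Finset.abs_sum_le_sum_abs _ _).trans ?_
    calc _ ≤ ∑ l : Fin n, |(C ^ (j : ℕ)) i l| * (k : ℤ) := by
          refine Finset.sum_le_sum fun l _ => ?_
          rw [abs_mul]
          exact mul_le_mul_of_nonneg_left (hu l) (abs_nonneg _)
      _ = (∑ l : Fin n, |(C ^ (j : ℕ)) i l|) * (k : ℤ) := by rw [Finset.sum_mul]
      _ ≤ _ := by
          refine mul_le_mul_of_nonneg_right ?_ (by positivity)
          simp only [B]
          push_cast
          refine le_trans ?_ (Finset.single_le_sum (f := fun j : Fin n => ∑ i : Fin n, ∑ l : Fin n, |(C ^ (j : ℕ)) i l|) (fun _ _ => by positivity) (Finset.mem_univ j))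
          exact (Finset.single_le_sum (f := fun i : Fin n => ∑ l : Fin n, |(C ^ (j : ℕ)) i l|) (fun _ _ => by positivity) (Finset.mem_univ i))
  have h2 := Matrix.det_le h1
  simp only [AbsoluteValue.abs_apply, Fintype.card_fin] at h2
  zify
  refine h2.trans (le_of_eq ?_)
  simp [mul_pow, mul_assoc]

theorem pigeon {n : ℕ} (hn : 0 < n) (P : Matrix (Fin n) (Fin n) ℤ) (hP : P.det ≠ 0) :
    ∃ (k : ℕ) (w : Fin n → ℤ), w ≠ 0 ∧ k ^ n ≤ P.det.natAbs ∧ ∀ i, |(P *ᵥ w) i| ≤ k := by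
  set J := P.det.natAbs with hJ
  have hJ0 : 0 < J := Int.natAbs_pos.2 hP
  obtain ⟨k, hk1, hk2⟩ : ∃ k : ℕ, k ^ n ≤ J ∧ J < (k + 1) ^ n := by
    have hex : ∃ m : ℕ, J < m ^ n := ⟨J + 1, (Nat.lt_succ_self J).trans_le (Nat.le_self_pow hn.ne' _)⟩
    classical
    have h1 := Nat.find_spec hex
    have h0 : Nat.find hex ≠ 0 := by
      intro h; rw [h, zero_pow hn.ne'] at h1; omega
    obtain ⟨k, hk⟩ := Nat.exists_eq_succ_of_ne_zero h0
    refine ⟨k, ?_, by rw [hk] at h1; exact h1⟩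
    exact not_lt.1 (Nat.find_min hex (by omega))
  let N : Submodule ℤ (Fin n → ℤ) := LinearMap.range (Matrix.toLin' P)
  have hinj : Function.Injective (Matrix.toLin' P) := by
    intro x y hxy
    simp only [toLin'_apply] at hxy
    by_contra hne
    exact hP (Matrix.exists_mulVec_eq_zero_iff.1 ⟨x - y, sub_ne_zero.2 hne, by
      rw [mulVec_sub, hxy, sub_self]⟩)
  let e := LinearEquiv.ofInjective (Matrix.toLin' P) hinj
  have hcard : Nat.card ((Fin n → ℤ) ⧸ N) = J := by
    rw [← Submodule.natAbs_det_equiv N e, hJ]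
    congr 1
    rw [← LinearMap.det_toLin' P]
    congr 1
  have hfin : Finite ((Fin n → ℤ) ⧸ N) := Nat.finite_of_card_ne_zero (by omega)
  have := Fintype.ofFinite ((Fin n → ℤ) ⧸ N)
  obtain ⟨x, y, hxy, hq⟩ := Fintype.exists_ne_map_eq_of_card_lt
    (fun x : Fin n → Fin (k + 1) => N.mkQ (fun i => ((x i : ℕ) : ℤ))) (by
      rw [← Nat.card_eq_fintype_card, hcard]; simpa using hk2)
  have hmem : (fun i => ((x i : ℕ) : ℤ)) - (fun i => ((y i : ℕ) : ℤ)) ∈ N :=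
    (Submodule.Quotient.eq N).1 hq
  obtain ⟨w, hw⟩ := hmem
  rw [toLin'_apply] at hw
  refine ⟨k, w, ?_, hk1, ?_⟩
  · rintro rfl
    rw [mulVec_zero] at hw
    apply hxy
    ext i
    have := congrFun hw i
    simp at this
    omega
  · intro i
    rw [hw]
    have h1 := (x i).2
    have h2 := (y i).2
    simp only [Pi.sub_apply]
    rw [abs_le]; constructor <;> omega

theorem small_kry {n : ℕ} (hn : 0 < n) (f : Polynomial ℤ) : ∃ c : ℕ,
    ∀ M : Matrix (Fin n) (Fin n) ℤ, M.charpoly = f → (∀ v ≠ 0, (kry M v).det ≠ 0) →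
    ∃ w, (kry M w).det ≠ 0 ∧ (kry M w).det.natAbs ≤ c := by
  obtain ⟨c, hc⟩ := kry_bound (compan f : Matrix (Fin n) (Fin n) ℤ)
  refine ⟨c, fun M hM hcyc => ?_⟩
  let v0 : Fin n → ℤ := fun _ => 1
  have hv0 : v0 ≠ 0 := fun h => one_ne_zero (congrFun h ⟨0, hn⟩)
  have hP := hcyc v0 hv0
  have hMP := kry_comp M v0
  rw [hM] at hMP
  set P := kry M v0
  set C : Matrix (Fin n) (Fin n) ℤ := compan f
  have hcomm : P.adjugate * M = C * P.adjugate := by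
    have h1 : P.adjugate * (M * P) * P.adjugate = P.adjugate * (P * C) * P.adjugate := by rw [hMP]
    have h2 : P.det • (P.adjugate * M) = P.det • (C * P.adjugate) := by
      calc P.det • (P.adjugate * M) = P.adjugate * M * (P * P.adjugate) := by
            rw [mul_adjugate, Matrix.mul_smul, Matrix.mul_one]
        _ = P.adjugate * (M * P) * P.adjugate := by simp only [Matrix.mul_assoc]
        _ = P.adjugate * (P * C) * P.adjugate := h1
        _ = (P.adjugate * P) * C * P.adjugate := by simp only [Matrix.mul_assoc]
        _ = _ := by rw [adjugate_mul, Matrix.smul_mul, Matrix.one_mul, Matrix.smul_mul]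
    exact smul_right_injective _ hP h2
  have hdet : P.adjugate.det ≠ 0 := by
    rw [det_adjugate]; exact pow_ne_zero _ hP
  obtain ⟨k, w, hw, hk, hb⟩ := pigeon hn P.adjugate hdet
  refine ⟨w, hcyc w hw, ?_⟩
  have h3 := hc k _ hb
  rw [← kry_map _ _ _ hcomm, det_mul, Int.natAbs_mul] at h3
  have h4 : P.adjugate.det.natAbs * (kry M w).det.natAbs ≤ P.adjugate.det.natAbs * c := by
    refine h3.trans ?_
    rw [mul_comm]; exact Nat.mul_le_mul_right _ hk
  exact Nat.le_of_mul_le_mul_left h4 (Int.natAbs_pos.2 hdet)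

theorem conj_of_cong_kry {n : ℕ} (M M' C Q Q' X : Matrix (Fin n) (Fin n) ℤ)
    (h : M * Q = Q * C) (h' : M' * Q' = Q' * C) (hd : Q.det ≠ 0) (hdd : Q'.det = Q.det)
    (hX : Q' - Q = Q.det • X) : IsConj M M' := by
  set U := 1 + X * Q.adjugate with hU
  have hUQ : U * Q = Q' := by
    rw [hU, Matrix.add_mul, Matrix.mul_assoc, adjugate_mul, Matrix.mul_smul, Matrix.mul_one,
      Matrix.one_mul, ← hX]
    abel
  have hUd : U.det = 1 := by
    have := congrArg Matrix.det hUQ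
    rw [det_mul, hdd] at this
    exact mul_right_cancel₀ hd (by rw [this, one_mul])
  have hUM : U * M = M' * U := by
    have h2 : U * M * Q = M' * U * Q := by
      rw [Matrix.mul_assoc, h, ← Matrix.mul_assoc, hUQ, Matrix.mul_assoc, hUQ, h']
    have h3 : U * M * (Q * Q.adjugate) = M' * U * (Q * Q.adjugate) := by
      rw [← Matrix.mul_assoc, h2, Matrix.mul_assoc]
    rw [mul_adjugate] at h3
    simp only [Matrix.mul_smul, Matrix.mul_one] at h3
    exact smul_right_injective _ hd h3
  exact ⟨Matrix.nonsingInvUnit U (by rw [hUd]; exact isUnit_one), hUM⟩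

theorem fin_cyc {n : ℕ} (hn : 0 < n) (f : Polynomial ℤ) :
    (ConjClasses.mk '' {M : Matrix (Fin n) (Fin n) ℤ | M.charpoly = f ∧
      ∀ v ≠ 0, (kry M v).det ≠ 0}).Finite := by
  obtain ⟨c, hc⟩ := small_kry hn f
  refine fin_of_inv (σ := Σ d : Set.Icc (-(c : ℤ)) c, Matrix (Fin n) (Fin n) (Fin (c + 1))) _
    (fun M s => ∃ w, (kry M w).det ≠ 0 ∧ (kry M w).det = s.1.1 ∧
      ∀ i j, (kry M w i j) % (kry M w).det = (s.2 i j).1) ?_ ?_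
  · rintro M ⟨hM, hcyc⟩
    obtain ⟨w, hw, hwc⟩ := hc M hM hcyc
    refine ⟨⟨⟨(kry M w).det, by constructor <;> omega⟩, Matrix.of fun i j =>
      ⟨((kry M w i j) % (kry M w).det).natAbs, ?_⟩⟩, w, hw, rfl, ?_⟩
    · have := Int.emod_lt_abs (kry M w i j) hw
      have := Int.emod_nonneg (kry M w i j) hw
      rw [Int.abs_eq_natAbs] at *
      omega
    · intro i j
      have := Int.emod_nonneg (kry M w i j) hw
      simp only [of_apply]
      omega
  · rintro M M' s ⟨hM, -⟩ ⟨hM', -⟩ ⟨w, hw, hws, hwr⟩ ⟨w', hw', hws', hwr'⟩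
    have hdd : (kry M' w').det = (kry M w).det := hws'.trans hws.symm
    have hdiv : ∀ i j, ∃ z, (kry M' w' - kry M w) i j = (kry M w).det * z := by
      intro i j
      have h1 := (hwr' i j).trans (hwr i j).symm
      rw [hdd] at h1
      exact Int.ModEq.dvd (Eq.symm h1)
    choose Z hZ using hdiv
    have e1 := kry_comp M w
    have e2 := kry_comp M' w'
    rw [hM] at e1
    rw [hM'] at e2
    exact conj_of_cong_kry M M' (compan f) (kry M w) (kry M' w') (Matrix.of Z) e1 e2 hw hdd
      (by ext i j; rw [hZ]; simp)

theorem fin_charpoly (n : ℕ) (hn : 0 < n) :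
    {f : Polynomial ℤ | ∃ M : Matrix (Fin n) (Fin n) ℤ, IsOfFinOrder M ∧ M.charpoly = f}.Finite := by
  refine (Polynomial.finite_mahlerMeasure_le n 1).subset ?_
  rintro f ⟨M, hM, rfl⟩
  refine ⟨by simp [Matrix.charpoly_natDegree_eq_dim], ?_⟩
  rw [Polynomial.mahlerMeasure_eq_leadingCoeff_mul_prod_roots]
  have hmon := (M.charpoly_monic.map (Int.castRingHom ℂ))
  rw [hmon.leadingCoeff, norm_one, one_mul]
  obtain ⟨k, hk, hk1⟩ := isOfFinOrder_iff_pow_eq_one.1 hM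
  refine le_of_eq (Multiset.prod_eq_one ?_)
  intro x hx
  obtain ⟨z, hz, rfl⟩ := Multiset.mem_map.1 hx
  rw [Polynomial.mem_roots hmon.ne_zero, ← Matrix.charpoly_map, ← Matrix.mem_spectrum_iff_isRoot_charpoly] at hz
  have h2 := spectrum.pow_mem_pow _ k hz
  have h3 : ((Int.castRingHom ℂ).mapMatrix M) ^ k = 1 := by rw [← map_pow, hk1, map_one]
  have : Nonempty (Fin n) := ⟨⟨0, hn⟩⟩
  change z ^ k ∈ spectrum ℂ (((Int.castRingHom ℂ).mapMatrix M) ^ k) at h2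
  rw [h3, spectrum.one_eq] at h2
  have h5 : ‖z‖ = 1 := Complex.norm_eq_one_of_pow_eq_one h2 hk.ne'
  simp [h5]

theorem reducible {n : ℕ} (hn : 0 < n) (M : Matrix (Fin n) (Fin n) ℤ) (v : Fin n → ℤ) (hv : v ≠ 0)
    (hd : (kry M v).det = 0) : ∃ a b : ℕ, a < n ∧ b < n ∧ ∃ e : Fin a ⊕ Fin b ≃ Fin n, ∃ A B D,
      IsConj (reindexAlgEquiv ℤ ℤ e (fromBlocks A B 0 D)) M := by
  obtain ⟨y, hy, hyk⟩ := Matrix.exists_vecMul_eq_zero_iff.2 hd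
  have hall : ∀ j : ℕ, y ⬝ᵥ (M ^ j *ᵥ v) = 0 := by
    intro j
    have h1 : SemiconjBy (kry M v) (compan M.charpoly) M := (kry_comp M v).symm
    have h2 := (h1.pow_right j).eq
    have h3 : y ᵥ* (M ^ j * kry M v) = 0 := by
      rw [← h2, ← vecMul_vecMul, hyk, zero_vecMul]
    have h4 := congrFun h3 ⟨0, hn⟩
    have h5 : (y ᵥ* (M ^ j * kry M v)) ⟨0, hn⟩ = y ⬝ᵥ (M ^ j *ᵥ (M ^ 0 *ᵥ v)) := rfl
    rw [h5] at h4
    simpa using h4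
  let L : Submodule ℤ (Fin n → ℤ) :=
    { carrier := {x | ∀ j : ℕ, y ⬝ᵥ (M ^ j *ᵥ x) = 0}
      zero_mem' := by intro j; simp
      add_mem' := by intro p q hp hq j; simp [mulVec_add, hp j, hq j]
      smul_mem' := by intro c p hp j; rw [mulVec_smul, dotProduct_smul, hp j, smul_zero] }
  have hLinv : ∀ x ∈ L, M *ᵥ x ∈ L := by
    intro x hx j
    have := hx (j + 1)
    rwa [pow_succ, ← mulVec_mulVec] at this
  have hsat : ∀ (c : ℤ) x, c ≠ 0 → c • x ∈ L → x ∈ L := by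
    intro c x hc hx j
    have := hx j
    rw [mulVec_smul, dotProduct_smul, smul_eq_zero] at this
    exact this.resolve_left hc
  have hvL : v ∈ L := hall
  have hLtop : L ≠ ⊤ := by
    intro h
    apply hy
    have : y ∈ L := h ▸ trivial
    have := this 0
    simpa using this
  have htf : Module.IsTorsionFree ℤ ((Fin n → ℤ) ⧸ L) := by
    refine Module.IsTorsionFree.of_smul_eq_zero fun c x hx => ?_
    obtain ⟨x, rfl⟩ := L.mkQ_surjective x
    by_cases hc : c = 0
    · exact Or.inl hc
    · right
      rw [← map_smul] at hx
      exact (Submodule.Quotient.mk_eq_zero L).2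
        (hsat c x hc ((Submodule.Quotient.mk_eq_zero L).1 hx))
  have hfree : Module.Free ℤ ((Fin n → ℤ) ⧸ L) := inferInstance
  obtain ⟨g, hg⟩ := LinearMap.exists_rightInverse_of_surjective L.mkQ (by simp)
  obtain ⟨N, hN⟩ : ∃ N, IsCompl L N := by
    refine ⟨_, LinearMap.isCompl_of_proj (f := LinearMap.codRestrict L
      (LinearMap.id - g ∘ₗ L.mkQ) fun x => ?_) fun x => ?_⟩
    · rw [← Submodule.Quotient.mk_eq_zero L]
      have := LinearMap.congr_fun hg (L.mkQ x)
      change L.mkQ (x - g (L.mkQ x)) = 0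
      rw [map_sub, sub_eq_zero]
      exact this.symm
    · apply Subtype.ext
      have : L.mkQ (x : Fin n → ℤ) = 0 := (Submodule.Quotient.mk_eq_zero L).2 x.2
      change (x : Fin n → ℤ) - g (L.mkQ x) = x
      rw [this, map_zero, sub_zero]
  let bL := Module.finBasis ℤ L
  let bN := Module.finBasis ℤ N
  let bb := (bL.prod bN).map (Submodule.prodEquivOfIsCompl L N hN)
  have hcard : Module.finrank ℤ L + Module.finrank ℤ N = n := by
    have := Module.finrank_eq_card_basis bb
    simpa using this.symm
  have hLpos : 0 < Module.finrank ℤ L := by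
    have : Nontrivial L := ⟨⟨⟨v, hvL⟩, 0, fun h => hv (congrArg Subtype.val h)⟩⟩
    exact Module.finrank_pos
  have hNpos : 0 < Module.finrank ℤ N := by
    have : Nontrivial N := by
      rw [Submodule.nontrivial_iff_ne_bot]
      rintro rfl
      exact hLtop (by simpa using hN.sup_eq_top)
    exact Module.finrank_pos
  let e : Fin (Module.finrank ℤ L) ⊕ Fin (Module.finrank ℤ N) ≃ Fin n :=
    finSumFinEquiv.trans (finCongr hcard)
  let W := LinearMap.toMatrix bb bb (Matrix.toLin' M)
  refine ⟨_, _, by omega, by omega, e, W.toBlocks₁₁, W.toBlocks₁₂, W.toBlocks₂₂, ?_⟩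
  have hW : fromBlocks W.toBlocks₁₁ W.toBlocks₁₂ 0 W.toBlocks₂₂ = W := by
    conv_rhs => rw [← fromBlocks_toBlocks W]
    congr 1
    ext i j
    have h1 : bb (Sum.inl j) = (bL j : Fin n → ℤ) := by simp [bb]
    have h2 : W.toBlocks₂₁ i j = bb.repr (M *ᵥ (bb (Sum.inl j))) (Sum.inr i) := by
      simp [W, toBlocks₂₁, LinearMap.toMatrix_apply]
    have h3 : (Submodule.prodEquivOfIsCompl L N hN).symm (M *ᵥ (bL j : Fin n → ℤ)) =
        (⟨M *ᵥ (bL j : Fin n → ℤ), hLinv _ (bL j).2⟩, 0) :=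
      Submodule.prodEquivOfIsCompl_symm_apply_left L N hN ⟨M *ᵥ (bL j : Fin n → ℤ), hLinv _ (bL j).2⟩
    rw [h2, h1]
    simp [bb, h3]
  rw [hW]
  let b' := bb.reindex e
  have hW' : reindexAlgEquiv ℤ ℤ e W = LinearMap.toMatrix b' b' (Matrix.toLin' M) := by
    ext i j
    simp [W, b', LinearMap.toMatrix_apply]
  rw [hW']
  let s := Pi.basisFun ℤ (Fin n)
  refine ⟨⟨s.toMatrix b', b'.toMatrix s, s.toMatrix_mul_toMatrix_flip b',
    b'.toMatrix_mul_toMatrix_flip s⟩, ?_⟩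
  have h1 := basis_toMatrix_mul_linearMap_toMatrix b' s b' (Matrix.toLin' M)
  have h2 := linearMap_toMatrix_mul_basis_toMatrix b' s s (Matrix.toLin' M)
  have h3 : LinearMap.toMatrix s s (Matrix.toLin' M) = M := by
    simp only [s, LinearMap.toMatrix_eq_toMatrix', LinearMap.toMatrix'_toLin']
  rw [h3] at h2
  exact h1.trans h2.symm

theorem fin_all (n : ℕ) :
    (ConjClasses.mk '' {M : Matrix (Fin n) (Fin n) ℤ | IsOfFinOrder M}).Finite := by
  induction n using Nat.strong_induction_on with
  | _ n ih =>
  rcases Nat.eq_zero_or_pos n with rfl | hn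
  · exact Set.toFinite _
  have h1 : (⋃ f ∈ {f : Polynomial ℤ | ∃ M : Matrix (Fin n) (Fin n) ℤ, IsOfFinOrder M ∧ M.charpoly = f},
    (ConjClasses.mk '' {M : Matrix (Fin n) (Fin n) ℤ | M.charpoly = f ∧
      ∀ v ≠ 0, (kry M v).det ≠ 0})).Finite := (fin_charpoly n hn).biUnion fun f _ => fin_cyc hn f
  have h2 : (⋃ a : Fin n, ⋃ b : Fin n, ⋃ e : Fin a ⊕ Fin b ≃ Fin n,
    ⋃ A ∈ (ConjClasses.mk '' {M : Matrix (Fin a) (Fin a) ℤ | IsOfFinOrder M}),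
    ⋃ D ∈ (ConjClasses.mk '' {M : Matrix (Fin b) (Fin b) ℤ | IsOfFinOrder M}),
    (ConjClasses.mk '' {M : Matrix (Fin n) (Fin n) ℤ | IsOfFinOrder M ∧
      ∃ B, IsConj (reindexAlgEquiv ℤ ℤ e (fromBlocks (Quotient.out A) B 0 (Quotient.out D))) M})).Finite := by
    refine Set.finite_iUnion fun a => Set.finite_iUnion fun b => Set.finite_iUnion fun e =>
      (ih a a.2).biUnion fun A hA => (ih b b.2).biUnion fun D hD => fin_block e _ _ ?_ ?_
    · obtain ⟨A', hA', rfl⟩ := hA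
      exact (ConjClasses.mk_eq_mk_iff_isConj.1 (Quotient.out_eq (ConjClasses.mk A'))).symm.tors hA'
    · obtain ⟨A', hA', rfl⟩ := hD
      exact (ConjClasses.mk_eq_mk_iff_isConj.1 (Quotient.out_eq (ConjClasses.mk A'))).symm.tors hA'
  refine (h1.union h2).subset ?_
  rintro _ ⟨M, hM, rfl⟩
  by_cases hc : ∀ v ≠ 0, (kry M v).det ≠ 0
  · left
    simp only [Set.mem_iUnion]
    exact ⟨M.charpoly, ⟨M, hM, rfl⟩, M, ⟨rfl, hc⟩, rfl⟩
  · right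
    push Not at hc
    obtain ⟨v, hv, hd⟩ := hc
    obtain ⟨a, b, ha, hb, e, A, B, D, hconj⟩ := reducible hn M v hv hd
    have htor : IsOfFinOrder (fromBlocks A B 0 D) := by
      have h3 := MonoidHom.isOfFinOrder (reindexAlgEquiv ℤ ℤ e).symm.toMulEquiv.toMonoidHom
        (hconj.symm.tors hM)
      have h4 : (reindexAlgEquiv ℤ ℤ e).symm.toMulEquiv.toMonoidHom
        (reindexAlgEquiv ℤ ℤ e (fromBlocks A B 0 D)) = fromBlocks A B 0 D :=
        (reindexAlgEquiv ℤ ℤ e).symm_apply_apply _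
      rwa [h4] at h3
    obtain ⟨k, hk, hk1⟩ := isOfFinOrder_iff_pow_eq_one.1 htor
    rw [blk_pow, ← fromBlocks_one, fromBlocks_inj] at hk1
    have hA : IsOfFinOrder A := isOfFinOrder_iff_pow_eq_one.2 ⟨k, hk, hk1.1⟩
    have hD : IsOfFinOrder D := isOfFinOrder_iff_pow_eq_one.2 ⟨k, hk, hk1.2.2.2⟩
    simp only [Set.mem_iUnion]
    refine ⟨⟨a, ha⟩, ⟨b, hb⟩, e, ConjClasses.mk A, ⟨A, hA, rfl⟩, ConjClasses.mk D, ⟨D, hD, rfl⟩,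
      M, ⟨hM, ?_⟩, rfl⟩
    obtain ⟨U, hU⟩ : IsConj (Quotient.out (ConjClasses.mk A)) A :=
      ConjClasses.mk_eq_mk_iff_isConj.1 (Quotient.out_eq (ConjClasses.mk A))
    obtain ⟨V, hV⟩ : IsConj (Quotient.out (ConjClasses.mk D)) D :=
      ConjClasses.mk_eq_mk_iff_isConj.1 (Quotient.out_eq (ConjClasses.mk D))
    generalize Quotient.out (ConjClasses.mk A) = A0 at *
    generalize Quotient.out (ConjClasses.mk D) = D0 at *
    refine ⟨(U⁻¹).val * B * V.val, IsConj.trans ?_ hconj⟩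
    refine IsConj.map' (reindexAlgEquiv ℤ ℤ e).toMulEquiv.toMonoidHom
      (x := fromBlocks A0 ((U⁻¹).val * B * V.val) 0 D0)
      (y := fromBlocks A B 0 D) ?_
    refine ⟨⟨fromBlocks U.val 0 0 V.val, fromBlocks (U⁻¹).val 0 0 (V⁻¹).val, ?_, ?_⟩, ?_⟩
    · simp [fromBlocks_multiply, fromBlocks_one]
    · simp [fromBlocks_multiply, fromBlocks_one]
    · have e1 := hU.eq
      have e2 := hV.eq
      have e3 : U.val * ((U⁻¹).val * B * V.val) = B * V.val := by
        rw [← Matrix.mul_assoc, ← Matrix.mul_assoc]; simp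
      simp only [SemiconjBy, fromBlocks_multiply, e1, e2, e3]; simp

theorem finitely_many_torsion_conjugacy_classes (n : ℕ) :
    ∃ T : Finset (GL (Fin n) ℤ),
      ∀ η : GL (Fin n) ℤ, IsOfFinOrder η → ∃ t ∈ T, IsConj t η := by
  have hfin := fin_all n
  have : Finite (ConjClasses.mk '' {M : Matrix (Fin n) (Fin n) ℤ | IsOfFinOrder M}) := hfin
  have h2 : (ConjClasses.mk '' {η : GL (Fin n) ℤ | IsOfFinOrder η}).Finite := by
    refine fin_of_inv (σ := ConjClasses.mk '' {M : Matrix (Fin n) (Fin n) ℤ | IsOfFinOrder M}) _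
      (fun η s => ConjClasses.mk (η : Matrix (Fin n) (Fin n) ℤ) = s.1) ?_ ?_
    · intro η hη
      exact ⟨⟨_, _, MonoidHom.isOfFinOrder (Units.coeHom _) hη, rfl⟩, rfl⟩
    · intro η θ s _ _ h1 h2
      obtain ⟨c, hc⟩ := ConjClasses.mk_eq_mk_iff_isConj.1 (h1.trans h2.symm)
      exact isConj_iff.2 ⟨c, by
        rw [mul_inv_eq_iff_eq_mul]
        exact Units.ext hc.eq⟩
  classical
  refine ⟨h2.toFinset.image Quotient.out, fun η hη => ⟨Quotient.out (ConjClasses.mk η), ?_, ?_⟩⟩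
  · exact Finset.mem_image_of_mem _ (h2.mem_toFinset.2 ⟨η, hη, rfl⟩)
  · exact ConjClasses.mk_eq_mk_iff_isConj.1 (Quotient.out_eq (ConjClasses.mk η))
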